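/- Let ψ : Fin 2 → Fin 2 → Fin 2 → Fin 2 → ℂ be a four-qubit tensor, R(ψ) = T ψ̃ T† its associated 4×4 matrix, and P(ψ) = [[0, R(ψ)],[R(ψ)ᵀ, 0]] the associated 8×8 complex symmetric matrix. If A₁, A₂, A₃, A₄ ∈ SL(2,ℂ) and ψ′ = (A₁⊗A₂⊗A₃⊗A₄) ψ, then the characteristic polynomial of P(ψ′) equals the characteristic polynomial of P(ψ). In particular the eigenvalues of P(ψ) (with multiplicity) are invariant under all determinant-1 SLOCC operations. -/

import Mathlib

open Matrix

noncomputable section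

/-- The fixed matrix `T = (1/√2)·[[1,0,0,1],[0,i,i,0],[0,-1,1,0],[i,0,0,-i]]`. -/
noncomputable def Tmat : Matrix (Fin 4) (Fin 4) ℂ :=
  ((1 / Real.sqrt 2 : ℝ) : ℂ) •
    !![1, 0, 0, 1;
       0, Complex.I, Complex.I, 0;
       0, -1, 1, 0;
       Complex.I, 0, 0, -Complex.I]

/-- The index identification `(i,j) ↦ 2i+j` between `Fin 2 × Fin 2` (ordered 00,01,10,11)
and `Fin 4`. -/
def qIdx : Fin 2 × Fin 2 ≃ Fin 4 where
  toFun p := ⟨2 * p.1.val + p.2.val, by have h1 := p.1.isLt; have h2 := p.2.isLt; omega⟩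
  invFun k := (⟨k.val / 2, by have := k.isLt; omega⟩, ⟨k.val % 2, by have := k.isLt; omega⟩)
  left_inv := by decide
  right_inv := by decide

/-- Kronecker product of two `2×2` matrices as a `4×4` matrix (basis ordered 00,01,10,11). -/
def kron (A B : Matrix (Fin 2) (Fin 2) ℂ) : Matrix (Fin 4) (Fin 4) ℂ :=
  fun r c => A (qIdx.symm r).1 (qIdx.symm c).1 * B (qIdx.symm r).2 (qIdx.symm c).2

/-- The reshaping `ψ̃` of a four-qubit tensor into a `4×4` matrix, with row index
`(i₁,i₂)` and column index `(i₃,i₄)`, bases ordered 00,01,10,11. -/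
def reshape (ψ : Fin 2 → Fin 2 → Fin 2 → Fin 2 → ℂ) : Matrix (Fin 4) (Fin 4) ℂ :=
  fun r c => ψ (qIdx.symm r).1 (qIdx.symm r).2 (qIdx.symm c).1 (qIdx.symm c).2

/-- The matrix `R(ψ) = T ψ̃ T†`. -/
noncomputable def Rmat (ψ : Fin 2 → Fin 2 → Fin 2 → Fin 2 → ℂ) : Matrix (Fin 4) (Fin 4) ℂ :=
  Tmat * reshape ψ * Tmatᴴ

/-- The action of `A₁ ⊗ A₂ ⊗ A₃ ⊗ A₄` on a four-qubit tensor. -/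
def act (A₁ A₂ A₃ A₄ : Matrix (Fin 2) (Fin 2) ℂ) (ψ : Fin 2 → Fin 2 → Fin 2 → Fin 2 → ℂ) :
    Fin 2 → Fin 2 → Fin 2 → Fin 2 → ℂ :=
  fun i₁ i₂ i₃ i₄ => ∑ j₁, ∑ j₂, ∑ j₃, ∑ j₄,
    A₁ i₁ j₁ * A₂ i₂ j₂ * A₃ i₃ j₃ * A₄ i₄ j₄ * ψ j₁ j₂ j₃ j₄

/-- The `8×8` symmetric matrix `P(ψ) = [[0, R(ψ)],[R(ψ)ᵀ, 0]]` associated to a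
four-qubit tensor. -/
noncomputable def Pmat (ψ : Fin 2 → Fin 2 → Fin 2 → Fin 2 → ℂ) :
    Matrix (Fin 4 ⊕ Fin 4) (Fin 4 ⊕ Fin 4) ℂ :=
  Matrix.fromBlocks 0 (Rmat ψ) (Rmat ψ)ᵀ 0

theorem kron_mul_kron (A B C D : Matrix (Fin 2) (Fin 2) ℂ) :
    kron A B * kron C D = kron (A * C) (B * D) := by
  ext r c
  simp only [kron, mul_apply, Finset.sum_mul_sum]
  rw [← Equiv.sum_comp qIdx, Fintype.sum_prod_type]
  refine Finset.sum_congr rfl fun i _ => Finset.sum_congr rfl fun j _ => ?_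
  simp only [Equiv.symm_apply_apply]
  ring

theorem transpose_kron (A B : Matrix (Fin 2) (Fin 2) ℂ) : (kron A B)ᵀ = kron Aᵀ Bᵀ := rfl

/-- The standard symplectic form on `ℂ²`. -/
def symplecticForm : Matrix (Fin 2) (Fin 2) ℂ := !![0, 1; -1, 0]

theorem transpose_mul_symplecticForm_mul (A : Matrix (Fin 2) (Fin 2) ℂ) (h : A.det = 1) :
    Aᵀ * symplecticForm * A = symplecticForm := by
  rw [det_fin_two] at h
  ext i j
  fin_cases i <;> fin_cases j <;>
    simp [symplecticForm, mul_apply, Fin.sum_univ_two] <;> grind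

theorem transpose_kron_mul_form_mul (A B : Matrix (Fin 2) (Fin 2) ℂ)
    (hA : A.det = 1) (hB : B.det = 1) :
    (kron A B)ᵀ * kron symplecticForm symplecticForm * kron A B =
      kron symplecticForm symplecticForm := by
  rw [transpose_kron, kron_mul_kron, kron_mul_kron, transpose_mul_symplecticForm_mul A hA,
    transpose_mul_symplecticForm_mul B hB]

theorem ofReal_one_div_sqrt_two_mul_self :
    (((1 / Real.sqrt 2 : ℝ) : ℂ)) * ((1 / Real.sqrt 2 : ℝ) : ℂ) = 1 / 2 := by
  rw [← Complex.ofReal_mul, div_mul_div_comm, Real.mul_self_sqrt (by norm_num)]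
  norm_num

theorem transpose_Tmat_mul_Tmat : Tmatᵀ * Tmat = kron symplecticForm symplecticForm := by
  rw [Tmat, transpose_smul, smul_mul_smul_comm, ofReal_one_div_sqrt_two_mul_self]
  ext i j
  fin_cases i <;> fin_cases j <;>
    simp [symplecticForm, kron, qIdx, mul_apply, Fin.sum_univ_four] <;> norm_num

theorem conjTranspose_Tmat_mul_Tmat : Tmatᴴ * Tmat = 1 := by
  rw [Tmat, conjTranspose_smul, smul_mul_smul_comm, Complex.star_def, Complex.conj_ofReal,
    ofReal_one_div_sqrt_two_mul_self]
  ext i j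
  fin_cases i <;> fin_cases j <;>
    simp [mul_apply, Fin.sum_univ_four] <;> norm_num

theorem Tmat_mul_conjTranspose_Tmat : Tmat * Tmatᴴ = 1 :=
  mul_eq_one_comm.mp conjTranspose_Tmat_mul_Tmat

theorem reshape_act (A₁ A₂ A₃ A₄ : Matrix (Fin 2) (Fin 2) ℂ)
    (ψ : Fin 2 → Fin 2 → Fin 2 → Fin 2 → ℂ) :
    reshape (act A₁ A₂ A₃ A₄ ψ) = kron A₁ A₂ * reshape ψ * (kron A₃ A₄)ᵀ := by
  rw [Matrix.mul_assoc]
  ext r c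
  simp only [mul_apply, Finset.mul_sum, transpose_apply, kron, reshape, act]
  simp only [← Equiv.sum_comp qIdx, Fintype.sum_prod_type, Equiv.symm_apply_apply]
  refine Finset.sum_congr rfl fun i _ => Finset.sum_congr rfl fun j _ =>
    Finset.sum_congr rfl fun k _ => Finset.sum_congr rfl fun l _ => ?_
  ring

/-- Conjugation by `T` of a Kronecker product. -/
def conjT (A B : Matrix (Fin 2) (Fin 2) ℂ) : Matrix (Fin 4) (Fin 4) ℂ :=
  Tmat * kron A B * Tmatᴴ

theorem transpose_conjT_mul_conjT (A B : Matrix (Fin 2) (Fin 2) ℂ)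
    (hA : A.det = 1) (hB : B.det = 1) : (conjT A B)ᵀ * conjT A B = 1 := by
  calc (conjT A B)ᵀ * conjT A B
      = Tmatᴴᵀ * ((kron A B)ᵀ * (Tmatᵀ * Tmat) * kron A B) * Tmatᴴ := by
        simp only [conjT, transpose_mul, Matrix.mul_assoc]
    _ = (Tmat * Tmatᴴ)ᵀ * (Tmat * Tmatᴴ) := by
        rw [transpose_Tmat_mul_Tmat, transpose_kron_mul_form_mul A B hA hB,
          ← transpose_Tmat_mul_Tmat]
        simp only [transpose_mul, Matrix.mul_assoc]
    _ = 1 := by rw [Tmat_mul_conjTranspose_Tmat, transpose_one, Matrix.mul_one]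

theorem Rmat_act (A₁ A₂ A₃ A₄ : Matrix (Fin 2) (Fin 2) ℂ)
    (ψ : Fin 2 → Fin 2 → Fin 2 → Fin 2 → ℂ) :
    Rmat (act A₁ A₂ A₃ A₄ ψ) = conjT A₁ A₂ * Rmat ψ * conjT A₃ᵀ A₄ᵀ := by
  have h (M : Matrix (Fin 4) (Fin 4) ℂ) : Tmatᴴ * (Tmat * M) = M := by
    rw [← Matrix.mul_assoc, conjTranspose_Tmat_mul_Tmat, Matrix.one_mul]
  simp only [Rmat, reshape_act, conjT, transpose_kron, Matrix.mul_assoc, h]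

theorem charpoly_fromBlocks_orthogonal_mul {n R : Type*} [Fintype n] [DecidableEq n] [CommRing R]
    (M U V : Matrix n n R) (hU : Uᵀ * U = 1) (hV : V * Vᵀ = 1) :
    (fromBlocks 0 (U * M * V) (U * M * V)ᵀ 0).charpoly = (fromBlocks 0 M Mᵀ 0).charpoly := by
  have h : fromBlocks 0 (U * M * V) (U * M * V)ᵀ 0 =
      fromBlocks U 0 0 Vᵀ * (fromBlocks 0 M Mᵀ 0 * fromBlocks Uᵀ 0 0 V) := by
    simp [fromBlocks_multiply, Matrix.mul_assoc]
  rw [h, charpoly_mul_comm, Matrix.mul_assoc]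
  simp [fromBlocks_multiply, hU, hV]

/-- The characteristic polynomial of `P(ψ)` (hence the eigenvalues of `P(ψ)` with
multiplicity) is invariant under all determinant-1 SLOCC operations. -/
theorem charpoly_Pmat_slocc_invariant (ψ : Fin 2 → Fin 2 → Fin 2 → Fin 2 → ℂ)
    (A₁ A₂ A₃ A₄ : Matrix (Fin 2) (Fin 2) ℂ)
    (h₁ : A₁.det = 1) (h₂ : A₂.det = 1) (h₃ : A₃.det = 1) (h₄ : A₄.det = 1) :
    (Pmat (act A₁ A₂ A₃ A₄ ψ)).charpoly = (Pmat ψ).charpoly := by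
  rw [Pmat, Rmat_act]
  exact charpoly_fromBlocks_orthogonal_mul _ _ _ (transpose_conjT_mul_conjT A₁ A₂ h₁ h₂)
    (mul_eq_one_comm.mp (transpose_conjT_mul_conjT A₃ᵀ A₄ᵀ
      (by rwa [det_transpose]) (by rwa [det_transpose])))
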